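/- Let p ∈ (0,1) and let G be a real number with G > κ. Suppose (α_n, β_n) is a sequence of pairs in F(G) such that p·α_n + (1−p)·β_n → V(G) as n → ∞. Then α_n → α*(G) and β_n → β*(G) as n → ∞. -/

import Mathlib

open Real Filter

noncomputable def kap (p : ℝ) : ℝ := max (p / (1 - p)) ((1 - p) / p)

/-- The feasible set of the relaxed receiver problem (RR). -/
def Feas (G : ℝ) : Set (ℝ × ℝ) :=
  {ab | 0 ≤ ab.1 ∧ ab.1 ≤ 1 ∧ 0 ≤ ab.2 ∧ ab.2 ≤ 1 ∧
    ab.1 * ab.2 ≤ G * (1 - ab.1) * (1 - ab.2)}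

noncomputable def astar (p G : ℝ) : ℝ := (G - Real.sqrt ((1 - p) * G / p)) / (G - 1)

noncomputable def bstar (p G : ℝ) : ℝ := (G - Real.sqrt (p * G / (1 - p))) / (G - 1)

noncomputable def Vval (p G : ℝ) : ℝ := 1 - (2 * Real.sqrt (p * (1 - p) * G) - 1) / (G - 1)

lemma one_le_kap {p : ℝ} (hp0 : 0 < p) (hp1 : p < 1) : 1 ≤ kap p := by
  have hq : 0 < 1 - p := sub_pos.mpr hp1
  rcases le_total p (1 - p) with h | h
  · exact le_max_of_le_right ((one_le_div hp0).mpr h)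
  · exact le_max_of_le_left ((one_le_div hq).mpr h)

/-- In the coordinates `u = G - (G - 1) a`, `v = G - (G - 1) b` the feasibility constraint reads
`G ≤ u v`. -/
lemma le_mul_of_mem_Feas {G a b : ℝ} (hG : 1 < G) (h : (a, b) ∈ Feas G) :
    G ≤ (G - (G - 1) * a) * (G - (G - 1) * b) := by
  have h' : a * b ≤ G * (1 - a) * (1 - b) := h.2.2.2.2
  nlinarith [mul_nonneg (sub_pos.mpr hG).le (sub_nonneg.mpr h')]

/-- The weighted imbalance `p u - (1 - p) v` is controlled by the objective. -/
lemma sq_imbalance_le_of_mem_Feas {p G a b : ℝ} (hp0 : 0 < p) (hp1 : p < 1) (hG : 1 < G)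
    (h : (a, b) ∈ Feas G) :
    (p * (G - (G - 1) * a) - (1 - p) * (G - (G - 1) * b)) ^ 2 ≤
      (G - (G - 1) * (p * a + (1 - p) * b)) ^ 2 - 4 * (p * (1 - p) * G) := by
  have hpq : 0 ≤ p * (1 - p) := (mul_pos hp0 (sub_pos.mpr hp1)).le
  linear_combination 4 * mul_le_mul_of_nonneg_left (le_mul_of_mem_Feas hG h) hpq

theorem stmt_13 (p G : ℝ) (hp0 : 0 < p) (hp1 : p < 1) (hG : G > kap p)
    (α β : ℕ → ℝ) (hfeas : ∀ n, (α n, β n) ∈ Feas G)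
    (hconv : Filter.Tendsto (fun n => p * α n + (1 - p) * β n)
      Filter.atTop (nhds (Vval p G))) :
    Filter.Tendsto α Filter.atTop (nhds (astar p G)) ∧
    Filter.Tendsto β Filter.atTop (nhds (bstar p G)) := by
  have hG1 : 1 < G := (one_le_kap hp0 hp1).trans_lt hG
  have hq : 0 < 1 - p := sub_pos.mpr hp1
  have hg : G - 1 ≠ 0 := (sub_pos.mpr hG1).ne'
  set r := √(p * (1 - p) * G) with hr
  have hr2 : r ^ 2 = p * (1 - p) * G := Real.sq_sqrt (by positivity)
  have hr0 : 0 ≤ r := Real.sqrt_nonneg _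
  have ha : astar p G = (G - r / p) / (G - 1) := by
    have : (1 - p) * G / p = (r / p) ^ 2 := by
      rw [div_pow, hr2]; field_simp
    rw [astar, this, Real.sqrt_sq (by positivity)]
  have hb : bstar p G = (G - r / (1 - p)) / (G - 1) := by
    have : p * G / (1 - p) = (r / (1 - p)) ^ 2 := by
      rw [div_pow, hr2]; field_simp
    rw [bstar, this, Real.sqrt_sq (by positivity)]
  have hs : Tendsto (fun n => G - (G - 1) * (p * α n + (1 - p) * β n)) atTop (nhds (2 * r)) := by
    have hV : 2 * r = G - (G - 1) * Vval p G := by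
      rw [Vval, ← hr]; field_simp; ring
    rw [hV]
    exact (hconv.const_mul _).const_sub _
  have hsq : Tendsto (fun n => (p * (G - (G - 1) * α n) - (1 - p) * (G - (G - 1) * β n)) ^ 2)
      atTop (nhds 0) := by
    refine squeeze_zero (fun n => sq_nonneg _)
      (fun n => sq_imbalance_le_of_mem_Feas hp0 hp1 hG1 (hfeas n)) ?_
    have h := (hs.pow 2).sub_const (4 * (p * (1 - p) * G))
    rwa [← hr2, show (2 * r) ^ 2 - 4 * r ^ 2 = 0 by ring, hr2] at h
  have hd : Tendsto (fun n => p * (G - (G - 1) * α n) - (1 - p) * (G - (G - 1) * β n))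
      atTop (nhds 0) := by
    have h := hsq.sqrt
    simp only [Real.sqrt_sq_eq_abs, Real.sqrt_zero] at h
    exact (tendsto_zero_iff_abs_tendsto_zero _).mpr h
  constructor
  · rw [ha]
    convert (((hs.add hd).div_const (2 * p)).const_sub G).div_const (G - 1) using 2
    · field_simp; ring
    · field_simp; ring
  · rw [hb]
    convert (((hs.sub hd).div_const (2 * (1 - p))).const_sub G).div_const (G - 1) using 2
    · field_simp; ring
    · field_simp; ring
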